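/- (Correctness of the linear-search offline policy, Algorithm 1.) Let V = {1, 2, …, n} ⊆ ℕ, let μ : ℕ → ℝ satisfy 1 ≥ μ(1) ≥ μ(2) ≥ ⋯ ≥ μ(n) ≥ 0, fix a threshold Y ∈ ℕ, a unit cost η ≥ 0, and a budget b with 1 ≤ b ≤ n. Then the maximum of u(μ, A) over all nonempty subsets A ⊆ V with |A| ≤ b equals the maximum of u(μ, {1, 2, …, s}) over 1 ≤ s ≤ b; in particular, the offline optimum over all budget-feasible subsets is attained by a prefix set of devices with the largest success probabilities. -/

import Mathlib

/-- Success probability: probability that at least `Y` devices in `A` succeed. -/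
noncomputable def S (μ : ℕ → ℝ) (A : Finset ℕ) (Y : ℕ) : ℝ :=
  ∑ A' ∈ A.powerset.filter (fun A' => Y ≤ A'.card),
    (∏ ν ∈ A', μ ν) * (∏ ν ∈ A \ A', (1 - μ ν))

/-- Expected reward of an offloading decision `A`. -/
noncomputable def u (μ : ℕ → ℝ) (Y : ℕ) (η : ℝ) (A : Finset ℕ) : ℝ :=
  S μ A Y - η * A.card

theorem S_insert (μ : ℕ → ℝ) {A : Finset ℕ} {a : ℕ} (ha : a ∉ A) (Y : ℕ) :
    S μ (insert a A) Y = μ a * S μ A (Y - 1) + (1 - μ a) * S μ A Y := by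
  unfold S
  simp only [Finset.sum_filter]
  rw [Finset.sum_powerset_insert ha, add_comm, Finset.mul_sum, Finset.mul_sum]
  congr 1
  · refine Finset.sum_congr rfl fun t ht => ?_
    have hat : a ∉ t := fun h => ha (Finset.mem_powerset.1 ht h)
    have hsd : insert a A \ insert a t = A \ t := by
      ext x
      simp only [Finset.mem_sdiff, Finset.mem_insert]
      grind
    rw [Finset.card_insert_of_notMem hat, Finset.prod_insert hat, hsd]
    by_cases h : Y ≤ t.card + 1
    · rw [if_pos h, if_pos (by omega), mul_assoc]
    · rw [if_neg h, if_neg (by omega), mul_zero]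
  · refine Finset.sum_congr rfl fun t ht => ?_
    have hat : a ∉ t := fun h => ha (Finset.mem_powerset.1 ht h)
    rw [Finset.insert_sdiff_of_notMem _ hat, Finset.prod_insert (by simp [ha])]
    split_ifs
    · ring
    · simp

theorem S_antitone {μ : ℕ → ℝ} {A : Finset ℕ} (h : ∀ i ∈ A, 0 ≤ μ i ∧ μ i ≤ 1) :
    Antitone (S μ A) := by
  intro X Y hXY
  refine Finset.sum_le_sum_of_subset_of_nonneg
    (Finset.monotone_filter_right _ fun t _ ht => hXY.trans ht) fun t ht _ => ?_
  have htA := Finset.mem_powerset.1 (Finset.mem_filter.1 ht).1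
  exact mul_nonneg (Finset.prod_nonneg fun i hi => (h i (htA hi)).1)
    (Finset.prod_nonneg fun i hi => sub_nonneg.2 (h i (Finset.mem_sdiff.1 hi).1).2)

/-- Among the decisions of a given size, the prefix has the largest success probability. -/
theorem S_le_S_Icc_card {n : ℕ} {μ : ℕ → ℝ}
    (hbound : ∀ i, 1 ≤ i → i ≤ n → 0 ≤ μ i ∧ μ i ≤ 1)
    (hmono : ∀ i j, 1 ≤ i → i ≤ j → j ≤ n → μ j ≤ μ i) (A : Finset ℕ) :
    A ⊆ Finset.Icc 1 n → ∀ Y, S μ A Y ≤ S μ (Finset.Icc 1 A.card) Y := by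
  induction A using Finset.induction_on_max with
  | empty => simp
  | insert m A hm ih =>
    intro hA Y
    have hmA : m ∉ A := fun h => lt_irrefl m (hm m h)
    obtain ⟨hm1, hmn⟩ := Finset.mem_Icc.1 (hA (Finset.mem_insert_self m A))
    have hA' : A ⊆ Finset.Icc 1 n := (Finset.subset_insert m A).trans hA
    have hcard : A.card + 1 ≤ m := by
      have hsub : A ⊆ Finset.Ico 1 m := fun i hi =>
        Finset.mem_Ico.2 ⟨(Finset.mem_Icc.1 (hA' hi)).1, hm i hi⟩
      have := Finset.card_le_card hsub
      rw [Nat.card_Ico] at this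
      omega
    have hprefix : Finset.Icc 1 (A.card + 1) = insert (A.card + 1) (Finset.Icc 1 A.card) := by
      ext x
      simp only [Finset.mem_Icc, Finset.mem_insert]
      omega
    rw [Finset.card_insert_of_notMem hmA, hprefix, S_insert μ hmA, S_insert μ (by simp)]
    have hanti : S μ (Finset.Icc 1 A.card) Y ≤ S μ (Finset.Icc 1 A.card) (Y - 1) :=
      S_antitone (fun i hi => hbound i (Finset.mem_Icc.1 hi).1
        (by have := (Finset.mem_Icc.1 hi).2; omega)) (Nat.sub_le Y 1)
    have hμ := hmono (A.card + 1) m (by omega) hcard hmn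
    obtain ⟨h0, h1⟩ := hbound m hm1 hmn
    have hfst := mul_le_mul_of_nonneg_left (ih hA' (Y - 1)) h0
    have hsnd := mul_le_mul_of_nonneg_left (ih hA' Y) (sub_nonneg.2 h1)
    have hgain := mul_nonneg (sub_nonneg.2 hμ) (sub_nonneg.2 hanti)
    linarith

theorem stmt_5 (n : ℕ) (μ : ℕ → ℝ)
    (hbound : ∀ i, 1 ≤ i → i ≤ n → 0 ≤ μ i ∧ μ i ≤ 1)
    (hmono : ∀ i j, 1 ≤ i → i ≤ j → j ≤ n → μ j ≤ μ i)
    (Y : ℕ) (η : ℝ) (hη : 0 ≤ η) (b : ℕ) (hb1 : 1 ≤ b) (hbn : b ≤ n) :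
    sSup {x : ℝ | ∃ A : Finset ℕ,
        A ⊆ Finset.Icc 1 n ∧ A.Nonempty ∧ A.card ≤ b ∧ x = u μ Y η A}
      = sSup {x : ℝ | ∃ s : ℕ, 1 ≤ s ∧ s ≤ b ∧ x = u μ Y η (Finset.Icc 1 s)} := by
  have hsub : {x : ℝ | ∃ s : ℕ, 1 ≤ s ∧ s ≤ b ∧ x = u μ Y η (Finset.Icc 1 s)} ⊆
      {x : ℝ | ∃ A : Finset ℕ,
        A ⊆ Finset.Icc 1 n ∧ A.Nonempty ∧ A.card ≤ b ∧ x = u μ Y η A} := by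
    rintro x ⟨s, hs1, hsb, rfl⟩
    exact ⟨Finset.Icc 1 s, Finset.Icc_subset_Icc_right (hsb.trans hbn),
      Finset.nonempty_Icc.2 hs1, by simpa using hsb, rfl⟩
  have hbdd : BddAbove {x : ℝ | ∃ A : Finset ℕ,
      A ⊆ Finset.Icc 1 n ∧ A.Nonempty ∧ A.card ≤ b ∧ x = u μ Y η A} := by
    refine (((Finset.Icc 1 n).powerset.image (u μ Y η)).finite_toSet.subset ?_).bddAbove
    rintro x ⟨A, hA, -, -, rfl⟩
    exact Finset.mem_coe.2 (Finset.mem_image_of_mem _ (Finset.mem_powerset.2 hA))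
  have hne : {x : ℝ | ∃ s : ℕ, 1 ≤ s ∧ s ≤ b ∧ x = u μ Y η (Finset.Icc 1 s)}.Nonempty :=
    ⟨_, 1, le_rfl, hb1, rfl⟩
  refine le_antisymm (csSup_le (hne.mono hsub) ?_) (csSup_le_csSup hbdd hne hsub)
  rintro x ⟨A, hA, hAne, hAb, rfl⟩
  refine le_trans ?_ (le_csSup (hbdd.mono hsub) ⟨A.card, Finset.card_pos.2 hAne, hAb, rfl⟩)
  have hS := S_le_S_Icc_card hbound hmono A hA Y
  simpa [u] using hS
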